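/- In every irreducible finite Coxeter group of rank 3, each reflection is centralized by some other reflection: for any reflection r there exists a reflection r' ≠ r with rr' = r'r. -/

import Mathlib

open Module Polynomial.Chebyshev

/-- If `f y * g x = 4 * cos (π / m) ^ 2` with `3 ≤ m`, then the product of the two reflections
has order dividing `m`. -/
theorem Module.reflection_mul_reflection_pow_eq_one {V : Type*} [AddCommGroup V] [Module ℝ V]
    {x y : V} {f g : Dual ℝ V} (hf : f x = 2) (hg : g y = 2) {m : ℕ} (hm : 3 ≤ m)
    (h : f y * g x = 4 * Real.cos (Real.pi / m) ^ 2) :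
    (reflection hf * reflection hg) ^ m = 1 := by
  have hm' : (3 : ℝ) ≤ m := by exact_mod_cast hm
  set θ : ℝ := 2 * Real.pi / m with hθ
  have hmθ : (m : ℝ) * θ = 2 * Real.pi := by rw [hθ]; field_simp
  have hsin : Real.sin θ ≠ 0 := by
    refine (Real.sin_pos_of_pos_of_lt_pi (by positivity) ?_).ne'
    rw [hθ, div_lt_iff₀ (by positivity)]
    nlinarith [Real.pi_pos]
  have ht : 2 * Real.cos θ = f y * g x - 2 := by
    rw [h, hθ, mul_div_assoc, Real.cos_two_mul]
    ring
  have hS (n : ℤ) : (S ℝ n).eval (2 * Real.cos θ) = Real.sin ((n + 1) * θ) / Real.sin θ :=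
    eq_div_of_mul_eq hsin (S_two_mul_real_cos θ n)
  ext z
  rw [reflection_mul_reflection_pow_apply hf hg m z _ ht]
  obtain ⟨k, rfl | rfl⟩ := Nat.even_or_odd' m
  · have e₁ : ((2 * k : ℕ) - 2 : ℤ) / 2 = k - 1 := by lia
    have e₂ : ((2 * k : ℕ) - 1 : ℤ) / 2 = k - 1 := by lia
    have h₀ : (S ℝ (k - 1)).eval (2 * Real.cos θ) = 0 := by
      have : ((k - 1 : ℤ) + 1 : ℝ) * θ = Real.pi := by
        push_cast at hmθ ⊢
        linarith
      rw [hS, this, Real.sin_pi, zero_div]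
    rw [e₁, e₂, h₀]
    simp
  · have e₁ : ((2 * k + 1 : ℕ) - 2 : ℤ) / 2 = k - 1 := by lia
    have e₂ : ((2 * k + 1 : ℕ) - 1 : ℤ) / 2 = k := by lia
    have e₃ : ((2 * k + 1 : ℕ) - 3 : ℤ) / 2 = k - 1 := by lia
    have e₄ : ((2 * k + 1 : ℕ) : ℤ) / 2 = k := by lia
    have h₀ : (S ℝ k).eval (2 * Real.cos θ) + (S ℝ (k - 1)).eval (2 * Real.cos θ) = 0 := by
      have : ((k : ℤ) + 1 : ℝ) * θ = 2 * Real.pi - ((k - 1 : ℤ) + 1 : ℝ) * θ := by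
        push_cast at hmθ ⊢
        linarith
      rw [hS, hS, this, Real.sin_two_pi_sub]
      ring
    rw [e₁, e₂, e₃, e₄, h₀]
    simp

namespace CoxeterMatrix

variable {B : Type*} (M : CoxeterMatrix B)

/-- The entry `-2 * cos (π / M i j)` of the symmetric Cartan matrix of a Coxeter matrix. When
`M i j = 0`, the entry is `-2`. -/
noncomputable def cartan (i j : B) : ℝ := -2 * Real.cos (Real.pi / M i j)

theorem cartan_self (i : B) : M.cartan i i = 2 := by simp [cartan]

theorem cartan_comm (i j : B) : M.cartan i j = M.cartan j i := by
  rw [cartan, cartan, M.symmetric]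

theorem cartan_eq_zero {i j : B} (h : M i j = 2) : M.cartan i j = 0 := by simp [cartan, h]

/-- The simple coroot attached to `i`, as a linear form on `B → ℝ`. -/
noncomputable def coroot [Fintype B] (i : B) : Dual ℝ (B → ℝ) :=
  ∑ j, M.cartan i j • LinearMap.proj j

theorem coroot_single [Fintype B] [DecidableEq B] (i j : B) :
    M.coroot i (Pi.single j 1) = M.cartan i j := by
  simp [coroot, Pi.single_apply]

theorem coroot_single_self [Fintype B] [DecidableEq B] (i : B) :
    M.coroot i (Pi.single i 1) = 2 := by
  rw [coroot_single, cartan_self]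

theorem isLiftable_reflection [Fintype B] [DecidableEq B] :
    M.IsLiftable fun i ↦ reflection (M.coroot_single_self i) := by
  intro i j
  rcases eq_or_ne i j with rfl | hij
  · rw [M.diagonal, pow_one]
    ext1 z
    exact involutive_reflection _ z
  have h1 := M.off_diagonal i j hij
  obtain h | h | h : M i j = 0 ∨ M i j = 2 ∨ 3 ≤ M i j := by lia
  · rw [h, pow_zero]
  · rw [h]
    ext1 z
    have hi := M.cartan_eq_zero h
    have hj := M.cartan_comm i j ▸ hi
    simp only [pow_two, LinearEquiv.mul_apply, reflection_apply, map_sub, map_smul,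
      coroot_single, cartan_self, hi, hj, LinearEquiv.coe_one, id]
    module
  · refine reflection_mul_reflection_pow_eq_one _ _ h ?_
    rw [coroot_single, coroot_single, M.cartan_comm j i, cartan]
    ring

end CoxeterMatrix

/-- A finite group of linear automorphisms of `B → ℝ` preserves a positive definite symmetric
bilinear form. -/
theorem exists_invariant_posDef_bilinForm {B W : Type*} [Fintype B] [Group W] [Finite W]
    (ρ : W →* ((B → ℝ) ≃ₗ[ℝ] (B → ℝ))) :
    ∃ Q : LinearMap.BilinForm ℝ (B → ℝ), (∀ w x y, Q (ρ w x) (ρ w y) = Q x y) ∧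
      (∀ x y, Q x y = Q y x) ∧ ∀ x, x ≠ 0 → 0 < Q x x := by
  have := Fintype.ofFinite W
  refine ⟨LinearMap.mk₂ ℝ (fun x y ↦ ∑ w, ρ w x ⬝ᵥ ρ w y) ?_ ?_ ?_ ?_, ?_, ?_, ?_⟩
  · simp [add_dotProduct, Finset.sum_add_distrib]
  · simp [Finset.mul_sum]
  · simp [dotProduct_add, Finset.sum_add_distrib]
  · simp [Finset.mul_sum]
  · intro w x y
    simp only [LinearMap.mk₂_apply, ← LinearEquiv.mul_apply, ← map_mul]
    exact Fintype.sum_equiv (Equiv.mulRight w) _ _ fun _ ↦ rfl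
  · intro x y
    simp only [LinearMap.mk₂_apply]
    exact Finset.sum_congr rfl fun w _ ↦ dotProduct_comm _ _
  · intro x hx
    rw [LinearMap.mk₂_apply]
    refine Finset.sum_pos (fun w _ ↦ ?_) Finset.univ_nonempty
    have hne : ρ w x ≠ 0 := by simpa using hx
    have hnn : 0 ≤ ρ w x ⬝ᵥ ρ w x := Finset.sum_nonneg fun _ _ ↦ mul_self_nonneg _
    exact hnn.lt_of_ne fun h ↦ hne (dotProduct_self_eq_zero.mp h.symm)

namespace CoxeterSystem

section

variable {B W : Type*} [Group W] {M : CoxeterMatrix B} (cs : CoxeterSystem M W)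

/-- The geometric representation of a Coxeter group on `B → ℝ`. -/
noncomputable def geometricRep [Fintype B] [DecidableEq B] : W →* ((B → ℝ) ≃ₗ[ℝ] (B → ℝ)) :=
  cs.lift ⟨_, M.isLiftable_reflection⟩

theorem geometricRep_simple [Fintype B] [DecidableEq B] (i : B) (x : B → ℝ) :
    cs.geometricRep (cs.simple i) x = x - M.coroot i x • Pi.single i 1 := by
  rw [geometricRep, cs.lift_apply_simple M.isLiftable_reflection, reflection_apply]

theorem simple_ne_simple_of_eq_two [Fintype B] {i j : B} (h : M i j = 2) :
    cs.simple j ≠ cs.simple i := by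
  classical
  intro he
  have h₁ := cs.geometricRep_simple i (Pi.single i 1)
  rw [← he, geometricRep_simple, M.coroot_single_self, M.coroot_single, M.cartan_comm,
    M.cartan_eq_zero h] at h₁
  have h₂ := congrFun h₁ i
  norm_num at h₂

theorem simple_mul_comm_of_eq_two {i j : B} (h : M i j = 2) :
    cs.simple i * cs.simple j = cs.simple j * cs.simple i := by
  have h₁ := cs.simple_mul_simple_pow i j
  rw [h, pow_two] at h₁
  simpa using eq_inv_of_mul_eq_one_left h₁

/-- Simple reflections joined by an edge with odd label are conjugate. -/
theorem exists_conj_simple_of_odd {i j : B} (h : Odd (M i j)) :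
    ∃ w, cs.simple i = w * cs.simple j * w⁻¹ := by
  obtain ⟨k, hk⟩ := h
  refine ⟨(cs.simple j * cs.simple i) ^ k, ?_⟩
  have hinv : (cs.simple j * cs.simple i)⁻¹ = cs.simple i * cs.simple j := by simp
  have hsc : SemiconjBy (cs.simple j) (cs.simple i * cs.simple j)
      (cs.simple j * cs.simple i) := by
    simp [SemiconjBy, mul_assoc]
  have hp := cs.simple_mul_simple_pow' i j
  rw [hk, pow_succ, two_mul, pow_add] at hp
  rw [← inv_pow, hinv, mul_assoc, (hsc.pow_right k).eq, ← mul_assoc,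
    eq_inv_of_mul_eq_one_left hp, hinv, simple_mul_simple_cancel_right]

end

/-- In a finite Coxeter group, the Cartan form is positive at `a • αᵢ + αⱼ + αₖ`, where `αᵢ`, `αⱼ`
and `αₖ` are the simple roots of a connected subdiagram `j - i - k`. -/
theorem cartan_form_pos {B W : Type*} [Group W] {M : CoxeterMatrix B}
    (cs : CoxeterSystem M W) [Fintype B] [Finite W] {i j k : B} (hij : i ≠ j) (hjk : j ≠ k)
    (hj : M.cartan i j ≠ 0) (hk : M.cartan i k ≠ 0) (a : ℝ) :
    0 < a ^ 2 + 2 + a * (M.cartan i j + M.cartan i k) + M.cartan j k := by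
  classical
  obtain ⟨Q, hinv, hsymm, hpos⟩ := exists_invariant_posDef_bilinForm cs.geometricRep
  have key (p q : B) : 2 * Q (Pi.single p 1) (Pi.single q 1) =
      M.cartan p q * Q (Pi.single p 1) (Pi.single p 1) := by
    have h := hinv (cs.simple p) (Pi.single p 1) (Pi.single q 1)
    simp only [geometricRep_simple, M.coroot_single, M.cartan_self, map_sub, map_smul,
      LinearMap.sub_apply, LinearMap.smul_apply, smul_eq_mul] at h
    linarith
  have same {q : B} (hq : M.cartan i q ≠ 0) :
      Q (Pi.single q 1) (Pi.single q 1) = Q (Pi.single i 1) (Pi.single i 1) := by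
    have h₁ := key i q
    rw [hsymm, key q i, M.cartan_comm] at h₁
    exact mul_left_cancel₀ hq h₁
  have hQ : 0 < Q (Pi.single i 1) (Pi.single i 1) := hpos _ (by simp)
  have hv : a • Pi.single i 1 + Pi.single j 1 + Pi.single k (1 : ℝ) ≠ 0 := by
    intro h
    have := congrFun h j
    simp [hij.symm, hjk] at this
  have h := hpos _ hv
  have h₁ := key i j
  have h₂ := key i k
  have h₃ := key j k
  rw [same hj] at h₃
  simp only [map_add, map_smul, LinearMap.add_apply, LinearMap.smul_apply, smul_eq_mul,
    hsymm (Pi.single j 1) (Pi.single i 1), hsymm (Pi.single k 1), same hj, same hk] at h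
  refine pos_of_mul_pos_left (b := Q (Pi.single i 1) (Pi.single i 1)) ?_ hQ.le
  linarith [congrArg (a * ·) h₁, congrArg (a * ·) h₂]

end CoxeterSystem

namespace CoxeterMatrix

variable {B : Type*} (M : CoxeterMatrix B)

theorem cartan_le {i j : B} {n : ℕ} (hn : 1 ≤ n) (h : M i j = 0 ∨ n ≤ M i j) :
    M.cartan i j ≤ -2 * Real.cos (Real.pi / n) := by
  have hn' : (1 : ℝ) ≤ n := by exact_mod_cast hn
  have hle : Real.pi / M i j ≤ Real.pi / n := by
    rcases h with h | h
    · rw [h, Nat.cast_zero, div_zero]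
      positivity
    · have : (n : ℝ) ≤ M i j := by exact_mod_cast h
      gcongr
  have := Real.cos_le_cos_of_nonneg_of_le_pi (x := Real.pi / M i j) (y := Real.pi / n)
    (by positivity) (div_le_self Real.pi_pos.le hn') hle
  rw [cartan]
  linarith

theorem cartan_le_neg_one {i j : B} (h : M i j = 0 ∨ 3 ≤ M i j) : M.cartan i j ≤ -1 := by
  have := M.cartan_le (by norm_num) h
  rw [Nat.cast_ofNat, Real.cos_pi_div_three] at this
  linarith

theorem cartan_le_neg_sqrt_two {i j : B} (h : M i j = 0 ∨ 4 ≤ M i j) :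
    M.cartan i j ≤ -√2 := by
  have := M.cartan_le (by norm_num) h
  rw [Nat.cast_ofNat, Real.cos_pi_div_four] at this
  linarith

end CoxeterMatrix

namespace CoxeterSystem

variable {B W : Type*} [Group W] {M : CoxeterMatrix B} (cs : CoxeterSystem M W)

/-- The reflection `t` commutes with some other reflection. -/
def HasCommutingReflection (t : W) : Prop :=
  ∃ t', cs.IsReflection t' ∧ t' ≠ t ∧ t * t' = t' * t

variable {cs}

theorem HasCommutingReflection.conj {t : W} (h : cs.HasCommutingReflection t) (w : W) :
    cs.HasCommutingReflection (w * t * w⁻¹) := by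
  obtain ⟨t', h₁, h₂, h₃⟩ := h
  refine ⟨w * t' * w⁻¹, h₁.conj w, by simpa using h₂, ?_⟩
  simp only [← MulAut.conj_apply, ← map_mul, h₃]

variable (cs)

theorem hasCommutingReflection_simple_of_eq_two [Fintype B] {i j : B} (h : M i j = 2) :
    cs.HasCommutingReflection (cs.simple i) :=
  ⟨cs.simple j, cs.isReflection_simple j, cs.simple_ne_simple_of_eq_two h,
    cs.simple_mul_comm_of_eq_two h⟩

theorem hasCommutingReflection_simple [Fintype B] [Finite W] {i j k : B} (hij : i ≠ j)
    (hik : i ≠ k) (hjk : j ≠ k) : cs.HasCommutingReflection (cs.simple i) := by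
  by_cases hj : M i j = 2
  · exact cs.hasCommutingReflection_simple_of_eq_two hj
  by_cases hk : M i k = 2
  · exact cs.hasCommutingReflection_simple_of_eq_two hk
  have oij := M.off_diagonal i j hij
  have oik := M.off_diagonal i k hik
  have ojk := M.off_diagonal j k hjk
  have cj := M.cartan_le_neg_one (i := i) (j := j) (by lia)
  have ck := M.cartan_le_neg_one (i := i) (j := k) (by lia)
  have hpos := cs.cartan_form_pos hij hjk (by linarith) (by linarith)
  by_cases h : M j k = 2
  · by_cases hoj : Odd (M i j)
    · obtain ⟨w, hw⟩ := cs.exists_conj_simple_of_odd hoj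
      exact hw ▸ (cs.hasCommutingReflection_simple_of_eq_two h).conj w
    by_cases hok : Odd (M i k)
    · obtain ⟨w, hw⟩ := cs.exists_conj_simple_of_odd hok
      exact hw ▸ (cs.hasCommutingReflection_simple_of_eq_two
        (M.symmetric k j ▸ h)).conj w
    rw [Nat.not_odd_iff] at hoj hok
    have cj := M.cartan_le_neg_sqrt_two (i := i) (j := j) (by lia)
    have ck := M.cartan_le_neg_sqrt_two (i := i) (j := k) (by lia)
    have := hpos √2
    rw [M.cartan_eq_zero h] at this
    nlinarith [Real.sq_sqrt (show (0 : ℝ) ≤ 2 by norm_num), Real.sqrt_nonneg 2]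
  · have := M.cartan_le_neg_one (i := j) (j := k) (by lia)
    linarith [hpos 1]

end CoxeterSystem

/-- In every irreducible finite Coxeter group of rank 3, each reflection is centralized by
some other reflection.  Irreducibility is phrased as: any subset of the three generators
which is "unjoined" (all edge labels `2`) to its complement is empty or everything. -/
theorem rank_three_reflection_centralized_by_other_reflection
    {W : Type*} [Group W] {M : CoxeterMatrix (Fin 3)} (cs : CoxeterSystem M W)
    [Finite W]
    (hirr : ∀ p : Fin 3 → Prop,
      (∀ i j : Fin 3, p i → ¬ p j → M i j = 2) → (∀ i, p i) ∨ (∀ i, ¬ p i))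
    (r : W) (hr : cs.IsReflection r) :
    ∃ r' : W, cs.IsReflection r' ∧ r' ≠ r ∧ r * r' = r' * r := by
  obtain ⟨w, i, rfl⟩ := hr
  have h : ∃ j k : Fin 3, i ≠ j ∧ i ≠ k ∧ j ≠ k := by decide +revert
  obtain ⟨j, k, hij, hik, hjk⟩ := h
  exact (cs.hasCommutingReflection_simple hij hik hjk).conj w
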